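/- arXiv:2102.04393 — 2 statements merged into one kernel-verified Lean document; each statement's English description precedes it below -/
import Mathlib

section
/- Assume (A, B) is controllable and (C, A) is observable. Then the set 𝒞̂_n of proper full-order stabilizing controllers, consisting of all quadruples (A_K, B_K, C_K, D_K) such that the block matrix [[A + B·D_K·C, B·C_K],[B_K·C, A_K]] is stable, is path-connected. -/
open Matrix

noncomputable section

/-- A real square matrix is stable (Hurwitz): every eigenvalue of the matrix,
regarded as a complex matrix, has negative real part. -/
def IsStableMatrix {k : Type*} [Fintype k] [DecidableEq k] (M : Matrix k k ℝ) : Prop :=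
  ∀ μ ∈ spectrum ℂ (M.map (algebraMap ℝ ℂ)), μ.re < 0

/-- `(A, B)` is controllable: the controllability matrix `[B, A·B, …, A^{r−1}·B]` has
rank `r`. -/
def Controllable {r s : ℕ} (A : Matrix (Fin r) (Fin r) ℝ) (B : Matrix (Fin r) (Fin s) ℝ) :
    Prop :=
  (Matrix.of fun (i : Fin r) (kj : Fin r × Fin s) => (A ^ (kj.1 : ℕ) * B) i kj.2).rank = r


set_option linter.unusedSectionVars false

section Basics

variable {k : Type*} [Fintype k] [DecidableEq k]

/-- complex eigenvector characterisation -/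
lemma mem_spectrum_iff_vec (M : Matrix k k ℂ) (μ : ℂ) :
    μ ∈ spectrum ℂ M ↔ ∃ v, v ≠ 0 ∧ M *ᵥ v = μ • v := by
  rw [spectrum.mem_iff, Matrix.isUnit_iff_isUnit_det, isUnit_iff_ne_zero, not_not,
    ← Matrix.exists_mulVec_eq_zero_iff]
  refine exists_congr fun v => and_congr_right fun _ => ?_
  rw [Matrix.sub_mulVec, sub_eq_zero, Algebra.algebraMap_eq_smul_one, Matrix.smul_mulVec,
    Matrix.one_mulVec, eq_comm]

lemma map_mulVec_re (M : Matrix k k ℝ) (v : k → ℂ) (i : k) :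
    ((M.map (algebraMap ℝ ℂ)) *ᵥ v) i = 
      ⟨(M *ᵥ fun j => (v j).re) i, (M *ᵥ fun j => (v j).im) i⟩ := by
  apply Complex.ext
  · simp [Matrix.mulVec, dotProduct]
  · simp [Matrix.mulVec, dotProduct]

/-- real characterisation of stability -/
lemma stable_iff (M : Matrix k k ℝ) : IsStableMatrix M ↔
    ∀ (a b : k → ℝ) (α β : ℝ), (a ≠ 0 ∨ b ≠ 0) → M *ᵥ a = α • a - β • b →
      M *ᵥ b = β • a + α • b → α < 0 := by
  constructor
  · intro h a b α β hab ha hb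
    refine h ⟨α, β⟩ ((mem_spectrum_iff_vec _ _).2 ⟨fun i => ⟨a i, b i⟩, ?_, ?_⟩)
    · intro h0
      have h1 : ∀ i, a i = 0 ∧ b i = 0 := fun i => by
        have := congrFun h0 i
        simpa [Complex.ext_iff] using this
      rcases hab with h2 | h2
      · exact h2 (funext fun i => (h1 i).1)
      · exact h2 (funext fun i => (h1 i).2)
    · funext i
      rw [map_mulVec_re]
      apply Complex.ext
      · simpa using congrFun ha i
      · simpa [add_comm] using congrFun hb i
  · intro h μ hμ
    obtain ⟨v, hv, hM⟩ := (mem_spectrum_iff_vec _ _).1 hμ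
    refine h (fun i => (v i).re) (fun i => (v i).im) μ.re μ.im ?_ ?_ ?_
    · by_contra! hc
      apply hv
      funext i
      exact Complex.ext (congrFun hc.1 i) (congrFun hc.2 i)
    · funext i
      have := congrArg Complex.re (congrFun hM i)
      rw [map_mulVec_re] at this
      simpa using this
    · funext i
      have := congrArg Complex.im (congrFun hM i)
      rw [map_mulVec_re] at this
      simpa [add_comm] using this

def QPos (M : Matrix k k ℝ) : Prop := ∀ x : k → ℝ, x ≠ 0 → 0 < x ⬝ᵥ (M *ᵥ x)

lemma QPos.det_ne {M : Matrix k k ℝ} (h : QPos M) : M.det ≠ 0 := by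
  intro h0
  obtain ⟨v, hv, h1⟩ := Matrix.exists_mulVec_eq_zero_iff.2 h0
  have := h v hv
  simp [h1] at this

lemma QPos.add {M N : Matrix k k ℝ} (h : QPos M) (h' : QPos N) : QPos (M + N) := by
  intro x hx
  rw [Matrix.add_mulVec, dotProduct_add]
  exact add_pos (h x hx) (h' x hx)

lemma QPos.smul {M : Matrix k k ℝ} (h : QPos M) {c : ℝ} (hc : 0 < c) : QPos (c • M) := by
  intro x hx
  rw [Matrix.smul_mulVec, dotProduct_smul]
  exact mul_pos hc (h x hx)

lemma QPos.convex {M N : Matrix k k ℝ} (h : QPos M) (h' : QPos N) {s t : ℝ} (hs : 0 ≤ s)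
    (ht : 0 ≤ t) (hst : s + t = 1) : QPos (s • M + t • N) := by
  rcases hs.eq_or_lt with rfl | hs
  · have : t = 1 := by linarith
    subst this; simpa using h'
  · rcases ht.eq_or_lt with rfl | ht
    · have : s = 1 := by linarith
      subst this; simpa using h
    · exact (h.smul hs).add (h'.smul ht)

lemma quad_congr (L M : Matrix k k ℝ) (x : k → ℝ) :
    x ⬝ᵥ ((L * M * Lᵀ) *ᵥ x) = (Lᵀ *ᵥ x) ⬝ᵥ (M *ᵥ (Lᵀ *ᵥ x)) := by
  rw [← Matrix.mulVec_mulVec, ← Matrix.mulVec_mulVec, Matrix.dotProduct_mulVec, 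
    ← Matrix.mulVec_transpose]

lemma QPos.congr {M : Matrix k k ℝ} (h : QPos M) (L : Matrix k k ℝ) (hL : L.det ≠ 0) :
    QPos (L * M * Lᵀ) := by
  intro x hx
  rw [quad_congr]
  apply h
  intro h0
  exact hx (Matrix.eq_zero_of_mulVec_eq_zero (by rwa [Matrix.det_transpose]) h0)

lemma QPos.of_congr {M L : Matrix k k ℝ} (hL : L.det ≠ 0) (h : QPos (L * M * Lᵀ)) :
    QPos M := by
  have h2 := h.congr L⁻¹ (by simpa [Matrix.det_nonsing_inv] using hL)
  have hu : IsUnit L.det := isUnit_iff_ne_zero.2 hL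
  have hu' : IsUnit Lᵀ.det := by rwa [Matrix.det_transpose]
  have e : L⁻¹ * (L * M * Lᵀ) * L⁻¹ᵀ = M := by
    rw [Matrix.transpose_nonsing_inv, ← Matrix.mul_assoc, ← Matrix.mul_assoc,
      Matrix.nonsing_inv_mul _ hu, Matrix.one_mul, Matrix.mul_assoc, Matrix.mul_nonsing_inv _ hu',
      Matrix.mul_one]
  rwa [e] at h2

lemma QPos.eventually {ι : Type*} {l : Filter ι} {f : ι → Matrix k k ℝ} {P : Matrix k k ℝ}
    (hP : QPos P) (hf : Filter.Tendsto f l (nhds P)) : ∀ᶠ a in l, QPos (f a) := by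
  have key : ∀ᶠ M in nhds P, ∀ x ∈ Metric.sphere (0 : k → ℝ) 1, 0 < x ⬝ᵥ (M *ᵥ x) := by
    refine (isCompact_sphere (0 : k → ℝ) 1).eventually_forall_of_forall_eventually ?_
    intro x hx
    have hx0 : x ≠ 0 := by
      rintro rfl; simp at hx
    have hc : Continuous fun z : Matrix k k ℝ × (k → ℝ) => z.2 ⬝ᵥ (z.1 *ᵥ z.2) := by
      fun_prop
    exact hc.continuousAt.eventually (lt_mem_nhds (hP x hx0))
  filter_upwards [hf.eventually key] with a ha x hx
  have hn : 0 < ‖x‖ := norm_pos_iff.2 hx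
  have h1 := ha (‖x‖⁻¹ • x) (by simp [norm_smul, hn.ne'])
  rw [Matrix.mulVec_smul, dotProduct_smul, smul_dotProduct, smul_smul, smul_eq_mul] at h1
  exact pos_of_mul_pos_right h1 (by positivity)

lemma quad_transpose (M : Matrix k k ℝ) (x : k → ℝ) : x ⬝ᵥ (Mᵀ *ᵥ x) = x ⬝ᵥ (M *ᵥ x) := by
  rw [Matrix.mulVec_transpose, dotProduct_comm, ← Matrix.dotProduct_mulVec]

/-- stability criterion -/
lemma stable_of_criterion (L M T R N : Matrix k k ℝ) (hR : L * T = R) (hN : L * M * T = N)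
    (hRs : Rᵀ = R) (hRp : QPos R) (hNp : QPos (-N)) : IsStableMatrix M := by
  rw [stable_iff]
  intro a b α β hab ha hb
  have hT : T.det ≠ 0 := by
    have := hRp.det_ne
    rw [← hR, Matrix.det_mul] at this
    exact right_ne_zero_of_mul this
  have hu : IsUnit T.det := isUnit_iff_ne_zero.2 hT
  obtain ⟨a, rfl⟩ : ∃ a', a = T *ᵥ a' := ⟨T⁻¹ *ᵥ a, by
    rw [Matrix.mulVec_mulVec, Matrix.mul_nonsing_inv _ hu, Matrix.one_mulVec]⟩
  obtain ⟨b, rfl⟩ : ∃ a', b = T *ᵥ a' := ⟨T⁻¹ *ᵥ b, by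
    rw [Matrix.mulVec_mulVec, Matrix.mul_nonsing_inv _ hu, Matrix.one_mulVec]⟩
  have ha' : N *ᵥ a = α • (R *ᵥ a) - β • (R *ᵥ b) := by
    have := congrArg (fun z => L *ᵥ z) ha
    simpa [Matrix.mulVec_sub, Matrix.mulVec_smul, Matrix.mulVec_mulVec, hR, hN, ← Matrix.mul_assoc] using this
  have hb' : N *ᵥ b = β • (R *ᵥ a) + α • (R *ᵥ b) := by
    have := congrArg (fun z => L *ᵥ z) hb
    simpa [Matrix.mulVec_add, Matrix.mulVec_smul, Matrix.mulVec_mulVec, hR, hN, ← Matrix.mul_assoc] using this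
  have hsym : a ⬝ᵥ (R *ᵥ b) = b ⬝ᵥ (R *ᵥ a) := by
    rw [Matrix.dotProduct_mulVec, ← Matrix.mulVec_transpose, hRs, dotProduct_comm]
  have e1 : a ⬝ᵥ (N *ᵥ a) = α * (a ⬝ᵥ (R *ᵥ a)) - β * (a ⬝ᵥ (R *ᵥ b)) := by
    rw [ha', dotProduct_sub, dotProduct_smul, dotProduct_smul]; rfl
  have e2 : b ⬝ᵥ (N *ᵥ b) = β * (b ⬝ᵥ (R *ᵥ a)) + α * (b ⬝ᵥ (R *ᵥ b)) := by
    rw [hb', dotProduct_add, dotProduct_smul, dotProduct_smul]; rfl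
  have nn : ∀ {Q : Matrix k k ℝ}, QPos Q → ∀ x, 0 ≤ x ⬝ᵥ (Q *ᵥ x) := by
    intro Q hQ x
    by_cases hx : x = 0
    · simp [hx]
    · exact (hQ x hx).le
  have hab' : a ≠ 0 ∨ b ≠ 0 := by
    rcases hab with h | h
    · left; rintro rfl; simp at h
    · right; rintro rfl; simp at h
  have s1 : 0 < a ⬝ᵥ (R *ᵥ a) + b ⬝ᵥ (R *ᵥ b) := by
    rcases hab' with h | h
    · exact add_pos_of_pos_of_nonneg (hRp a h) (nn hRp b)
    · exact add_pos_of_nonneg_of_pos (nn hRp a) (hRp b h)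
  have s2 : 0 < a ⬝ᵥ (-N *ᵥ a) + b ⬝ᵥ (-N *ᵥ b) := by
    rcases hab' with h | h
    · exact add_pos_of_pos_of_nonneg (hNp a h) (nn hNp b)
    · exact add_pos_of_nonneg_of_pos (nn hNp a) (hNp b h)
  rw [Matrix.neg_mulVec, Matrix.neg_mulVec, dotProduct_neg, dotProduct_neg, e1, e2, hsym] at s2
  by_contra hα
  push Not at hα
  nlinarith [mul_nonneg hα s1.le]

lemma stable_similar {M M' T T' : Matrix k k ℝ} (hT : T * T' = 1) (h : IsStableMatrix M)
    (hM : M' = T * M * T') : IsStableMatrix M' := by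
  have hT' : T' * T = 1 := mul_eq_one_comm.1 hT
  rw [stable_iff] at h ⊢
  intro a b α β hab ha hb
  have e : T' * M' = M * T' := by rw [hM, ← Matrix.mul_assoc, ← Matrix.mul_assoc, hT', Matrix.one_mul]
  have inj : ∀ x, T' *ᵥ x = 0 → x = 0 := fun x hx => by
    have := congrArg (fun z => T *ᵥ z) hx
    simpa [Matrix.mulVec_mulVec, hT] using this
  refine h (T' *ᵥ a) (T' *ᵥ b) α β (hab.imp (mt (inj a)) (mt (inj b))) ?_ ?_
  · rw [Matrix.mulVec_mulVec, ← e, ← Matrix.mulVec_mulVec, ha, Matrix.mulVec_sub,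
      Matrix.mulVec_smul, Matrix.mulVec_smul]
  · rw [Matrix.mulVec_mulVec, ← e, ← Matrix.mulVec_mulVec, hb, Matrix.mulVec_add,
      Matrix.mulVec_smul, Matrix.mulVec_smul]

lemma stable_of_nilpotent {M : Matrix k k ℝ} (h : IsNilpotent (M + 1)) : IsStableMatrix M := by
  intro μ hμ
  obtain ⟨v, hv, hM⟩ := (mem_spectrum_iff_vec _ _).1 hμ
  obtain ⟨r, hr⟩ := h
  have h1 : ((M + 1).map (algebraMap ℝ ℂ)) *ᵥ v = (μ + 1) • v := by
    rw [Matrix.map_add _ (by simp), Matrix.map_one _ (by simp) (by simp), Matrix.add_mulVec, hM,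
      Matrix.one_mulVec, add_smul, one_smul]
  have h2 : ∀ r : ℕ, (((M + 1).map (algebraMap ℝ ℂ)) ^ r) *ᵥ v = (μ + 1) ^ r • v := by
    intro r
    induction r with
    | zero => simp
    | succ r ih => 
      rw [pow_succ, ← Matrix.mulVec_mulVec, h1, Matrix.mulVec_smul, ih, smul_smul, pow_succ, mul_comm]
  have h3 := h2 r
  have h4 : ((M + 1).map (algebraMap ℝ ℂ)) ^ r = 0 := by
    have := Matrix.map_pow (M + 1) (algebraMap ℝ ℂ) r
    rw [← this, hr]; simp
  rw [h4, Matrix.zero_mulVec, eq_comm, smul_eq_zero] at h3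
  have h5 : μ + 1 = 0 := by
    rcases h3 with h3 | h3
    · by_contra hc
      exact pow_ne_zero r hc h3
    · exact absurd h3 hv
  have : μ = -1 := eq_neg_of_add_eq_zero_left h5
  simp [this]

end Basics


section Lyapunov

variable {k : Type*} [Fintype k] [DecidableEq k]

attribute [local instance] Matrix.linftyOpNormedRing Matrix.linftyOpNormedAlgebra in
lemma tendsto_pow_of_spectrum (Φ : Matrix k k ℂ) (h : ∀ z ∈ spectrum ℂ Φ, ‖z‖ < 1) :
    ∀ i j, Filter.Tendsto (fun r : ℕ => (Φ ^ r) i j) Filter.atTop (nhds 0) := by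
  intro i j
  have : Nonempty k := ⟨i⟩
  have : CompleteSpace (Matrix k k ℂ) := FiniteDimensional.complete ℂ _
  have h1 : spectralRadius ℂ Φ < (1 : NNReal) :=
    spectrum.spectralRadius_lt_of_forall_lt Φ (fun z hz => by exact_mod_cast h z hz)
  obtain ⟨c, hc1, hc2⟩ := exists_between h1
  have h2 := spectrum.pow_nnnorm_pow_one_div_tendsto_nhds_spectralRadius Φ
  have h3 := h2.eventually (gt_mem_nhds hc1)
  have hcne : c ≠ ⊤ := (hc2.trans ENNReal.coe_lt_top).ne
  lift c to NNReal using hcne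
  have hc3 : c < 1 := by exact_mod_cast hc2
  have h4 : ∀ᶠ r : ℕ in Filter.atTop, ‖(Φ ^ r) i j‖ ≤ (c : ℝ) ^ r := by
    filter_upwards [h3, Filter.eventually_gt_atTop 0] with r hr hr0
    have h5 : (‖Φ ^ r‖₊ : ENNReal) < (c : ENNReal) ^ r := by
      have := ENNReal.rpow_lt_rpow hr (z := (r : ℝ)) (by exact_mod_cast hr0)
      rw [← ENNReal.rpow_mul, one_div, inv_mul_cancel₀ (by exact_mod_cast hr0.ne'), ENNReal.rpow_one,
        ENNReal.rpow_natCast] at this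
      exact this
    have h6 : ‖Φ ^ r‖₊ < c ^ r := by exact_mod_cast h5
    have h7 : ‖(Φ ^ r) i j‖₊ ≤ ‖Φ ^ r‖₊ := by
      rw [Matrix.linfty_opNNNorm_def]
      refine le_trans ?_ (Finset.le_sup (Finset.mem_univ i))
      exact Finset.single_le_sum (f := fun j => ‖(Φ ^ r) i j‖₊) (fun _ _ => bot_le) (Finset.mem_univ j)
    exact_mod_cast h7.trans h6.le
  refine squeeze_zero_norm' h4 ?_
  exact tendsto_pow_atTop_nhds_zero_of_lt_one c.2 (by exact_mod_cast hc3)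

lemma lyapunov (M : Matrix k k ℝ) (h : IsStableMatrix M) :
    ∃ P : Matrix k k ℝ, Pᵀ = P ∧ QPos P ∧ QPos (-(M * P)) := by
  have hdet : (1 - M).det ≠ 0 := by
    intro h0
    obtain ⟨v, hv, h1⟩ := Matrix.exists_mulVec_eq_zero_iff.2 h0
    rw [Matrix.sub_mulVec, Matrix.one_mulVec, sub_eq_zero] at h1
    have := (stable_iff M).1 h v 0 1 0 (Or.inl hv) (by simp [← h1]) (by simp)
    linarith
  have hu : IsUnit (1 - M).det := isUnit_iff_ne_zero.2 hdet
  set S := (1 - M)⁻¹ with hS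
  have hS1 : (1 - M) * S = 1 := Matrix.mul_nonsing_inv _ hu
  set Φ := (1 + M) * S with hΦ
  set c := algebraMap ℝ ℂ with hc
  have hmapS : (1 - M.map c) * S.map c = 1 := by
    have := congrArg (fun N : Matrix k k ℝ => N.map c) hS1
    rw [Matrix.map_mul, Matrix.map_sub _ (by simp), Matrix.map_one _ (by simp) (by simp)] at this
    exact this
  have hmapΦ : Φ.map c = (1 + M.map c) * S.map c := by
    rw [hΦ, Matrix.map_mul, Matrix.map_add _ (by simp), Matrix.map_one _ (by simp) (by simp)]
  have hspec : ∀ z ∈ spectrum ℂ (Φ.map c), ‖z‖ < 1 := by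
    intro z hz
    obtain ⟨v, hv, hz⟩ := (mem_spectrum_iff_vec _ _).1 hz
    set w := S.map c *ᵥ v with hw
    have hvw : v = w - M.map c *ᵥ w := by
      have : (1 - M.map c) *ᵥ w = v := by
        rw [hw, Matrix.mulVec_mulVec, hmapS, Matrix.one_mulVec]
      rw [Matrix.sub_mulVec, Matrix.one_mulVec] at this
      exact this.symm
    have h1 : w + M.map c *ᵥ w = z • (w - M.map c *ᵥ w) := by
      rw [← hvw, ← hz, hmapΦ, ← Matrix.mulVec_mulVec, ← hw, Matrix.add_mulVec, Matrix.one_mulVec]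
    have hw0 : w ≠ 0 := by
      intro h0
      apply hv
      rw [hvw, h0]; simp
    have h2 : (z + 1) • (M.map c *ᵥ w) = (z - 1) • w := by
      rw [add_smul, sub_smul, one_smul, one_smul]
      rw [smul_sub] at h1
      linear_combination (exp := 1) h1
    have hz1 : z + 1 ≠ 0 := by
      intro h0
      rw [h0, zero_smul, eq_comm, smul_eq_zero] at h2
      rcases h2 with h2 | h2
      · have : (2 : ℂ) = 0 := by linear_combination h0 - h2
        norm_num at this
      · exact hw0 h2
    have h3 : M.map c *ᵥ w = ((z - 1) / (z + 1)) • w := by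
      rw [div_eq_inv_mul, mul_smul, ← h2, smul_smul, inv_mul_cancel₀ hz1, one_smul]
    have h4 := h _ ((mem_spectrum_iff_vec _ _).2 ⟨w, hw0, h3⟩)
    rw [Complex.div_re, ← add_div] at h4
    have h5 : 0 < Complex.normSq (z + 1) := Complex.normSq_pos.2 hz1
    have h6 := (div_neg_iff.1 h4).resolve_left (fun h => by linarith [h.2])
    simp at h6
    have h7 : Complex.normSq z < 1 := by
      rw [Complex.normSq_apply]; nlinarith [h6.1]
    rw [Complex.normSq_eq_norm_sq] at h7
    nlinarith [norm_nonneg z]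
  have htend : Filter.Tendsto (fun r : ℕ => Φ ^ r) Filter.atTop (nhds 0) := by
    refine tendsto_pi_nhds.2 fun i => tendsto_pi_nhds.2 fun j => ?_
    have h1 := tendsto_pow_of_spectrum _ hspec i j
    have h2 := (Complex.continuous_re.tendsto _).comp h1
    refine h2.congr fun r => ?_
    have : (Φ.map c) ^ r = (Φ ^ r).map c := (Matrix.map_pow _ _ _).symm
    rw [Function.comp_apply, this, Matrix.map_apply]
    exact Complex.ofReal_re _
  have hlim : Filter.Tendsto (fun r : ℕ => 1 - Φ ^ r * (Φ ^ r)ᵀ) Filter.atTop (nhds 1) := by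
    have hcont : Continuous fun N : Matrix k k ℝ => 1 - N * Nᵀ := by fun_prop
    have := (hcont.tendsto 0).comp htend
    simpa [Function.comp_def] using this
  have hone : QPos (1 : Matrix k k ℝ) := by
    intro x hx
    rw [Matrix.one_mulVec]
    have : 0 ≤ x ⬝ᵥ x := by
      rw [dotProduct]; exact Finset.sum_nonneg fun i _ => mul_self_nonneg _
    exact lt_of_le_of_ne this (fun h => hx (dotProduct_self_eq_zero.1 h.symm))
  obtain ⟨r, hr⟩ := (hone.eventually ((Filter.tendsto_add_atTop_iff_nat 1).2 hlim)).exists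
  set P := ∑ j ∈ Finset.range (r + 1), Φ ^ j * (Φ ^ j)ᵀ with hP
  have hPs : Pᵀ = P := by
    rw [hP, Matrix.transpose_sum]
    refine Finset.sum_congr rfl fun j _ => ?_
    rw [Matrix.transpose_mul, Matrix.transpose_transpose]
  have hsq : ∀ N : Matrix k k ℝ, ∀ x, 0 ≤ x ⬝ᵥ ((N * Nᵀ) *ᵥ x) := by
    intro N x
    have := quad_congr N 1 x
    rw [Matrix.mul_one] at this
    rw [this, Matrix.one_mulVec, dotProduct]
    exact Finset.sum_nonneg fun i _ => mul_self_nonneg _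
  have hPp : QPos P := by
    intro x hx
    rw [hP, Finset.sum_range_succ', Matrix.add_mulVec, dotProduct_add]
    refine add_pos_of_nonneg_of_pos ?_ ?_
    · rw [Matrix.sum_mulVec, dotProduct_sum]
      exact Finset.sum_nonneg fun j _ => hsq _ _
    · simpa using hone x hx
  have htel : ∀ r : ℕ, (∑ j ∈ Finset.range r, Φ ^ j * (Φ ^ j)ᵀ) -
      Φ * (∑ j ∈ Finset.range r, Φ ^ j * (Φ ^ j)ᵀ) * Φᵀ = 1 - Φ ^ r * (Φ ^ r)ᵀ := by
    intro r
    induction r with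
    | zero => simp
    | succ r ih =>
      rw [Finset.sum_range_succ, Matrix.mul_add, Matrix.add_mul, add_sub_add_comm, ih,
        pow_succ' Φ r, Matrix.transpose_mul Φ (Φ ^ r)]
      simp only [Matrix.mul_assoc]
      abel
  have hQ : QPos (P - Φ * P * Φᵀ) := by rw [hP, htel]; exact hr
  have hSdet : S.det ≠ 0 := by
    intro h0
    have := congrArg Matrix.det hS1
    rw [Matrix.det_mul, h0] at this
    simp at this
  have hS2 : Sᵀ * (1 - M)ᵀ = 1 := by rw [← Matrix.transpose_mul, hS1, Matrix.transpose_one]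
  refine ⟨S * P * Sᵀ, ?_, hPp.congr S hSdet, ?_⟩
  · simp [Matrix.transpose_mul, hPs, Matrix.mul_assoc]
  · have e : P - Φ * P * Φᵀ = (2 : ℝ) • (-(M * (S * P * Sᵀ)) + (-(M * (S * P * Sᵀ)))ᵀ) := by
      have e1 : P = (1 - M) * (S * P * Sᵀ) * (1 - M)ᵀ := by
        calc P = ((1 - M) * S) * P * (Sᵀ * (1 - M)ᵀ) := by rw [hS1, hS2]; simp
          _ = _ := by simp only [Matrix.mul_assoc]
      have e2 : Φ * P * Φᵀ = (1 + M) * (S * P * Sᵀ) * (1 + M)ᵀ := by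
        rw [hΦ, Matrix.transpose_mul]; simp only [Matrix.mul_assoc]
      have e3 : (S * P * Sᵀ)ᵀ = S * P * Sᵀ := by simp [Matrix.transpose_mul, hPs, Matrix.mul_assoc]
      rw [e2]
      nth_rewrite 1 [e1]
      rw [Matrix.transpose_neg, Matrix.transpose_mul M, e3]
      generalize S * P * Sᵀ = Q
      simp only [Matrix.transpose_sub, Matrix.transpose_add, Matrix.transpose_one]
      rw [two_smul]
      noncomm_ring
    rw [e] at hQ
    intro x hx
    have := hQ x hx
    rw [Matrix.smul_mulVec, dotProduct_smul, Matrix.add_mulVec, dotProduct_add, quad_transpose, smul_eq_mul] at this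
    linarith

end Lyapunov


section PolePlacement

lemma pole_placement_aux (U : Type) [AddCommGroup U] [Module ℝ U] : ∀ (d : ℕ) (V : Type) [AddCommGroup V]
    [Module ℝ V] [FiniteDimensional ℝ V], Module.finrank ℝ V = d → 
    ∀ (A : V →ₗ[ℝ] V) (B : U →ₗ[ℝ] V),
    (∀ W : Submodule ℝ V, (∀ x ∈ W, A x ∈ W) → (∀ u, B u ∈ W) → W = ⊤) →
    ∃ (F : V →ₗ[ℝ] U) (r : ℕ), ∀ x, (((A + B ∘ₗ F + LinearMap.id : Module.End ℝ V) ^ r) x) = 0 := by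
  intro d
  induction d with
  | zero =>
    intro V _ _ _ hd A B h
    have := Module.finrank_zero_iff.1 hd
    exact ⟨0, 0, fun x => Subsingleton.elim _ _⟩
  | succ d ih =>
    intro V _ _ _ hd A B h
    have hnt : Nontrivial V := Module.nontrivial_of_finrank_pos (R := ℝ) (by omega)
    obtain ⟨v, u, hv, hvu⟩ : ∃ v u, v ≠ 0 ∧ A v + B u = -v := by
      by_cases hinj : Function.Injective (A + LinearMap.id : V →ₗ[ℝ] V)
      · have hsurj := LinearMap.injective_iff_surjective.1 hinj
        obtain ⟨u, hu⟩ : ∃ u, B u ≠ 0 := by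
          by_contra! hc
          have := h ⊥ (by simp) (by simpa using hc)
          exact bot_ne_top this
        obtain ⟨v, hv⟩ := hsurj (-(B u))
        refine ⟨v, u, ?_, ?_⟩
        · rintro rfl
          rw [map_zero, eq_comm, neg_eq_zero] at hv
          exact hu hv
        · simp only [LinearMap.add_apply, LinearMap.id_apply] at hv
          have : B u = -(A v + v) := by rw [hv, neg_neg]
          rw [this]; abel
      · rw [← LinearMap.ker_eq_bot, Submodule.eq_bot_iff] at hinj
        push Not at hinj
        obtain ⟨v, hv, hv0⟩ := hinj
        refine ⟨v, 0, hv0, ?_⟩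
        rw [LinearMap.mem_ker] at hv
        simp only [LinearMap.add_apply, LinearMap.id_apply] at hv
        rw [map_zero, add_zero]
        exact eq_neg_of_add_eq_zero_left hv
    obtain ⟨f, hf⟩ : ∃ f : V →ₗ[ℝ] ℝ, f v = 1 :=
      Module.Projective.exists_dual_eq_one ℝ hv
    set F1 : V →ₗ[ℝ] U := f.smulRight u with hF1
    set A1 : V →ₗ[ℝ] V := A + B ∘ₗ F1 with hA1
    have hA1v : A1 v = -v := by
      simp [hA1, hF1, hf, hvu]
    set N : Submodule ℝ V := Submodule.span ℝ {v} with hN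
    have hAN : N ≤ N.comap A1 := by
      rw [hN, Submodule.span_singleton_le_iff_mem, Submodule.mem_comap, hA1v]
      exact N.neg_mem (Submodule.mem_span_singleton_self v)
    have hfin : Module.finrank ℝ (V ⧸ N) = d := by
      have h1 := Submodule.finrank_quotient_add_finrank N
      have h2 : Module.finrank ℝ N = 1 := finrank_span_singleton hv
      omega
    obtain ⟨F2, r, hr⟩ := ih (V ⧸ N) hfin (N.mapQ N A1 hAN) (N.mkQ ∘ₗ B) (by
      intro W hW1 hW2
      have h1 := h (W.comap N.mkQ) (by
        intro x hx
        have h2 : N.mkQ (A1 x) ∈ W := hW1 (N.mkQ x) hx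
        have h3 : N.mkQ (B (F1 x)) ∈ W := hW2 (F1 x)
        have h4 : A x = A1 x - B (F1 x) := by simp [hA1]
        rw [Submodule.mem_comap, h4, map_sub]
        exact W.sub_mem h2 h3) (fun u => hW2 u)
      rw [eq_top_iff]
      intro q _
      obtain ⟨x, rfl⟩ := N.mkQ_surjective q
      have : x ∈ W.comap N.mkQ := by rw [h1]; trivial
      exact this)
    refine ⟨F1 + F2 ∘ₗ N.mkQ, r + 1, ?_⟩
    set G : Module.End ℝ V := A + B ∘ₗ (F1 + F2 ∘ₗ N.mkQ) + LinearMap.id with hG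
    set Gq : Module.End ℝ (V ⧸ N) := N.mapQ N A1 hAN + (N.mkQ ∘ₗ B) ∘ₗ F2 + LinearMap.id with hGq
    have hcomm : ∀ x, N.mkQ (G x) = Gq (N.mkQ x) := by
      intro x
      simp only [hG, hGq, hA1, LinearMap.add_apply, LinearMap.comp_apply, LinearMap.id_apply, map_add,
        Submodule.mkQ_apply, Submodule.mapQ_apply, Submodule.Quotient.mk_add]
      abel
    have hcommr : ∀ (r : ℕ) x, N.mkQ ((G ^ r) x) = (Gq ^ r) (N.mkQ x) := by
      intro r
      induction r with
      | zero => intro x; simp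
      | succ r ih2 => 
        intro x
        rw [pow_succ, pow_succ, Module.End.mul_apply, Module.End.mul_apply, ih2, hcomm]
    have hGv : G v = 0 := by
      have h0 : N.mkQ v = 0 := by
        rw [Submodule.mkQ_apply, Submodule.Quotient.mk_eq_zero]
        exact Submodule.mem_span_singleton_self v
      have : G v = A1 v + B (F2 (N.mkQ v)) + v := by
        simp [hG, hA1, add_assoc]
      rw [this, h0, hA1v]; simp
    intro x
    have h1 : (G ^ r) x ∈ N := by
      rw [← Submodule.Quotient.mk_eq_zero, ← Submodule.mkQ_apply, hcommr, hr]
    obtain ⟨c, hc⟩ := Submodule.mem_span_singleton.1 h1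
    rw [pow_succ', Module.End.mul_apply, ← hc, map_smul, hGv, smul_zero]

lemma Controllable.subspace {r s : ℕ} {A : Matrix (Fin r) (Fin r) ℝ} {B : Matrix (Fin r) (Fin s) ℝ}
    (h : Controllable A B) (W : Submodule ℝ (Fin r → ℝ)) (hA : ∀ x ∈ W, A *ᵥ x ∈ W)
    (hB : ∀ u, B *ᵥ u ∈ W) : W = ⊤ := by
  unfold Controllable at h
  rw [Matrix.rank_eq_finrank_span_cols] at h
  have h1 := Submodule.eq_top_of_finrank_eq (h.trans (by simp : r = Module.finrank ℝ (Fin r → ℝ)))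
  rw [eq_top_iff, ← h1, Submodule.span_le]
  rintro _ ⟨kj, rfl⟩
  have h2 : ∀ q : ℕ, ∀ u, (A ^ q * B) *ᵥ u ∈ W := by
    intro q
    induction q with
    | zero => intro u; simpa using hB u
    | succ q ih =>
      intro u
      rw [pow_succ', Matrix.mul_assoc, ← Matrix.mulVec_mulVec]
      exact hA _ (ih u)
  have h3 := h2 kj.1 (Pi.single kj.2 1)
  rw [Matrix.mulVec_single_one] at h3
  exact h3

lemma pole_placement {r s : ℕ} {A : Matrix (Fin r) (Fin r) ℝ} {B : Matrix (Fin r) (Fin s) ℝ}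
    (h : Controllable A B) : ∃ F : Matrix (Fin s) (Fin r) ℝ, IsNilpotent (A + B * F + 1) := by
  obtain ⟨F, q, hq⟩ := pole_placement_aux (Fin s → ℝ) r (Fin r → ℝ) (by simp) (Matrix.toLin' A)
    (Matrix.toLin' B) (fun W h1 h2 => h.subspace W (by simpa using h1) (by simpa using h2))
  refine ⟨LinearMap.toMatrix' F, q, ?_⟩
  apply Matrix.toLin'.injective
  rw [Matrix.toLin'_pow, map_zero]
  refine LinearMap.ext fun x => ?_
  rw [LinearMap.zero_apply, ← hq x, map_add, map_add, Matrix.toLin'_mul, Matrix.toLin'_toMatrix', Matrix.toLin'_one]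

end PolePlacement


section Controllers

/-- the controller space -/
abbrev Ctl (n m p : ℕ) : Type := Matrix (Fin n) (Fin n) ℝ × Matrix (Fin n) (Fin p) ℝ ×
        Matrix (Fin m) (Fin n) ℝ × Matrix (Fin m) (Fin p) ℝ

variable {n m p : ℕ} (A : Matrix (Fin n) (Fin n) ℝ) (B : Matrix (Fin n) (Fin m) ℝ)
    (C : Matrix (Fin p) (Fin n) ℝ)

def CtlSet : Set (Ctl n m p) :=
  {K | IsStableMatrix (fromBlocks (A + B * K.2.2.2 * C) (B * K.2.2.1) (K.2.1 * C) K.1)}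

def act (T : Matrix (Fin n) (Fin n) ℝ) (K : Ctl n m p) : Ctl n m p :=
  (T * K.1 * T⁻¹, T * K.2.1, K.2.2.1 * T⁻¹, K.2.2.2)

lemma inv_of_mul {k : Type*} [Fintype k] [DecidableEq k] {T T' : Matrix k k ℝ} (h : T * T' = 1) :
    T.det ≠ 0 ∧ T⁻¹ = T' := by
  refine ⟨?_, Matrix.inv_eq_right_inv h⟩
  intro h0
  have := congrArg Matrix.det h
  rw [Matrix.det_mul, h0] at this
  simp at this

lemma mul_inv_of_det {k : Type*} [Fintype k] [DecidableEq k] {T : Matrix k k ℝ} (h : T.det ≠ 0) :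
    T * T⁻¹ = 1 := Matrix.mul_nonsing_inv _ (isUnit_iff_ne_zero.2 h)

lemma inv_mul_of_det {k : Type*} [Fintype k] [DecidableEq k] {T : Matrix k k ℝ} (h : T.det ≠ 0) :
    T⁻¹ * T = 1 := Matrix.nonsing_inv_mul _ (isUnit_iff_ne_zero.2 h)

lemma act_mul (T₁ T₂ : Matrix (Fin n) (Fin n) ℝ) (K : Ctl n m p) :
    act (T₁ * T₂) K = act T₁ (act T₂ K) := by
  simp [act, Matrix.mul_inv_rev, Matrix.mul_assoc]

lemma act_one (K : Ctl n m p) : act 1 K = K := by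
  simp [act]

variable {A B C}

lemma act_mem {T : Matrix (Fin n) (Fin n) ℝ} (hT : T.det ≠ 0) {K : Ctl n m p}
    (hK : K ∈ CtlSet A B C) : act T K ∈ CtlSet A B C := by
  have h1 := mul_inv_of_det hT
  refine stable_similar (T := fromBlocks 1 0 0 T) (T' := fromBlocks 1 0 0 T⁻¹) ?_ hK ?_
  · rw [fromBlocks_multiply]; simp [h1, fromBlocks_one]
  · rw [fromBlocks_multiply, fromBlocks_multiply]; simp [act, Matrix.mul_assoc]

lemma joined_act {T : Matrix (Fin n) (Fin n) ℝ} (hT : T.det ≠ 0) {K K' : Ctl n m p}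
    (h : JoinedIn (CtlSet A B C) K K') : JoinedIn (CtlSet A B C) (act T K) (act T K') := by
  have hc : Continuous (act T : Ctl n m p → Ctl n m p) := by
    unfold act; fun_prop
  refine (h.map hc).mono ?_
  rintro _ ⟨K, hK, rfl⟩
  exact act_mem hT hK

lemma joined_path {T T' : ℝ → Matrix (Fin n) (Fin n) ℝ} (hT : ContinuousOn T unitInterval)
    (hT' : ContinuousOn T' unitInterval) (h : ∀ t ∈ unitInterval, T t * T' t = 1) (h0 : T 0 = 1)
    {K : Ctl n m p} (hK : K ∈ CtlSet A B C) : JoinedIn (CtlSet A B C) (act (T 1) K) K := by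
  refine JoinedIn.symm (JoinedIn.ofLine (f := fun t => act (T t) K) ?_ (by simp [h0, act_one]) rfl ?_)
  · have : ContinuousOn (fun t => ((T t * K.1 * T' t, T t * K.2.1, K.2.2.1 * T' t, K.2.2.2) : Ctl n m p))
      unitInterval := by
      fun_prop
    refine this.congr fun t ht => ?_
    simp [act, (inv_of_mul (h t ht)).2]
  · rintro _ ⟨t, ht, rfl⟩
    exact act_mem (inv_of_mul (h t ht)).1 hK

lemma stable_perturb {k : Type*} [Fintype k] [DecidableEq k] {M M' : Matrix k k ℝ} (w : k → ℝ)
    (h : IsStableMatrix M) (hw : w ᵥ* M' = -w) (hM : ∀ x, w ⬝ᵥ x = 0 → M' *ᵥ x = M *ᵥ x) :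
    IsStableMatrix M' := by
  rw [stable_iff] at h ⊢
  intro a b α β hab ha hb
  have ea : -(w ⬝ᵥ a) = α * (w ⬝ᵥ a) - β * (w ⬝ᵥ b) := by
    have := congrArg (fun z => w ⬝ᵥ z) ha
    simpa [Matrix.dotProduct_mulVec, hw, neg_dotProduct, dotProduct_sub, dotProduct_smul] using this
  have eb : -(w ⬝ᵥ b) = β * (w ⬝ᵥ a) + α * (w ⬝ᵥ b) := by
    have := congrArg (fun z => w ⬝ᵥ z) hb
    simpa [Matrix.dotProduct_mulVec, hw, neg_dotProduct, dotProduct_add, dotProduct_smul] using this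
  by_cases h0 : w ⬝ᵥ a = 0 ∧ w ⬝ᵥ b = 0
  · exact h a b α β hab (by rw [← hM a h0.1, ha]) (by rw [← hM b h0.2, hb])
  · have hpos : 0 < (w ⬝ᵥ a) ^ 2 + (w ⬝ᵥ b) ^ 2 := by
      by_cases h1 : w ⬝ᵥ a = 0
      · have h2 : w ⬝ᵥ b ≠ 0 := fun h2 => h0 ⟨h1, h2⟩
        positivity
      · positivity
    have : (α + 1) * ((w ⬝ᵥ a) ^ 2 + (w ⬝ᵥ b) ^ 2) = 0 := by
      linear_combination -(w ⬝ᵥ a) * ea - (w ⬝ᵥ b) * eb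
    rcases mul_eq_zero.1 this with h3 | h3
    · linarith
    · exact absurd h3 hpos.ne'

lemma joined_reflect {K : Ctl n m p} (hK : K ∈ CtlSet A B C) (w v : Fin n → ℝ) (hwv : w ⬝ᵥ v = 1)
    (h1 : w ᵥ* K.1 = -w) (h2 : w ᵥ* K.2.1 = 0) :
    (1 - (2 : ℝ) • vecMulVec v w) * (1 - (2 : ℝ) • vecMulVec v w) = 1 ∧
    JoinedIn (CtlSet A B C) (act (1 - (2 : ℝ) • vecMulVec v w) K) K := by
  set E := vecMulVec v w with hE
  have hEE : E * E = E := by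
    rw [hE, Matrix.vecMulVec_mul_vecMulVec, hwv, one_smul]
  have hEA : E * K.1 = -E := by
    rw [hE, Matrix.vecMulVec_mul, h1, Matrix.vecMulVec_neg]
  have hEB : E * K.2.1 = 0 := by
    rw [hE, Matrix.vecMulVec_mul, h2]
    ext i j
    simp [vecMulVec]
  have hRR : (1 - (2 : ℝ) • E) * (1 - (2 : ℝ) • E) = 1 := by
    simp only [Matrix.sub_mul, Matrix.mul_sub, Matrix.one_mul, Matrix.mul_one, Matrix.smul_mul,
      Matrix.mul_smul, hEE]
    module
  refine ⟨hRR, ?_⟩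
  refine JoinedIn.symm (JoinedIn.ofLine (f := fun t => ((K.1 - (2 * t) • (K.1 * E + E), K.2.1,
    K.2.2.1 - (2 * t) • (K.2.2.1 * E), K.2.2.2) : Ctl n m p)) ?_ (by simp) ?_ ?_)
  · fun_prop
  · simp only [act, (inv_of_mul hRR).2]
    refine Prod.ext ?_ (Prod.ext ?_ (Prod.ext ?_ rfl))
    · simp only [Matrix.sub_mul, Matrix.mul_sub, Matrix.one_mul, Matrix.mul_one, Matrix.smul_mul,
        Matrix.mul_smul, hEA, Matrix.neg_mul, hEE]
      module
    · simp [Matrix.sub_mul, hEB]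
    · simp [Matrix.mul_sub]
  · rintro _ ⟨t, ht, rfl⟩
    refine stable_perturb (Sum.elim 0 w) hK ?_ ?_
    · have hwE : w ᵥ* E = w := by
        rw [hE, Matrix.vecMul_vecMulVec, hwv, one_smul]
      rw [Matrix.vecMul_fromBlocks]
      have e1 : w ᵥ* (K.2.1 * C) = 0 := by rw [← Matrix.vecMul_vecMul, h2, Matrix.zero_vecMul]
      have e2 : w ᵥ* (K.1 - (2 * t) • (K.1 * E + E)) = -w := by
        rw [Matrix.vecMul_sub, Matrix.vecMul_smul, Matrix.vecMul_add, ← Matrix.vecMul_vecMul, h1,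
          Matrix.neg_vecMul, hwE]
        simp
      funext i
      rcases i with i | i
      · simp [e1]
      · simp [-smul_add, e2]
    · intro x hx
      have hx2 : w ⬝ᵥ (x ∘ Sum.inr) = 0 := by
        simpa [dotProduct] using hx
      have hEx : E *ᵥ (x ∘ Sum.inr) = 0 := by
        rw [hE, Matrix.vecMulVec_mulVec, hx2]; simp
      rw [Matrix.fromBlocks_mulVec, Matrix.fromBlocks_mulVec]
      have e1 : (B * (K.2.2.1 - (2 * t) • (K.2.2.1 * E))) *ᵥ (x ∘ Sum.inr) = 
          (B * K.2.2.1) *ᵥ (x ∘ Sum.inr) := by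
        rw [← Matrix.mulVec_mulVec, Matrix.sub_mulVec, Matrix.smul_mulVec, ← Matrix.mulVec_mulVec, hEx]
        simp
      have e2 : (K.1 - (2 * t) • (K.1 * E + E)) *ᵥ (x ∘ Sum.inr) = K.1 *ᵥ (x ∘ Sum.inr) := by
        rw [Matrix.sub_mulVec, Matrix.smul_mulVec, Matrix.add_mulVec, ← Matrix.mulVec_mulVec, hEx]
        simp
      simp only [e1, e2]

/-- every change of coordinates fixes the component of a controller with a decoupled mode -/
lemma joined_all {K : Ctl n m p} (hK : K ∈ CtlSet A B C) (w : Fin n → ℝ) (hw : ∀ i, w i ≠ 0)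
    (h1 : w ᵥ* K.1 = -w) (h2 : w ᵥ* K.2.1 = 0) (T : Matrix (Fin n) (Fin n) ℝ) (hT : T.det ≠ 0) :
    JoinedIn (CtlSet A B C) (act T K) K := by
  have hmul : ∀ T₁ T₂ : Matrix (Fin n) (Fin n) ℝ, T₁.det ≠ 0 → T₂.det ≠ 0 →
      JoinedIn (CtlSet A B C) (act T₁ K) K → JoinedIn (CtlSet A B C) (act T₂ K) K →
      JoinedIn (CtlSet A B C) (act (T₁ * T₂) K) K := by
    intro T₁ T₂ d1 d2 j1 j2
    rw [act_mul]
    exact (joined_act d1 j2).trans j1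
  -- unipotent rank one
  have huni : ∀ v c : Fin n → ℝ, c ⬝ᵥ v = 0 → (1 + vecMulVec v c).det ≠ 0 ∧
      JoinedIn (CtlSet A B C) (act (1 + vecMulVec v c) K) K := by
    intro v c hcv
    have hsq : vecMulVec v c * vecMulVec v c = 0 := by
      rw [Matrix.vecMulVec_mul_vecMulVec, hcv, zero_smul, Matrix.vecMulVec_zero]
    have hinv : ∀ t : ℝ, (1 + t • vecMulVec v c) * (1 - t • vecMulVec v c) = 1 := by
      intro t
      simp only [Matrix.add_mul, Matrix.mul_sub, Matrix.one_mul, Matrix.mul_one, Matrix.smul_mul,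
        Matrix.mul_smul, hsq]
      module
    constructor
    · have := (inv_of_mul (hinv 1)).1
      simpa using this
    · have := joined_path (T := fun t => 1 + t • vecMulVec v c) (T' := fun t => 1 - t • vecMulVec v c)
        (by fun_prop) (by fun_prop) (fun t _ => hinv t) (by simp) hK
      simpa using this
  have hpos : ∀ (i : Fin n) (d : ℝ), 0 < d →
      JoinedIn (CtlSet A B C) (act (diagonal (Function.update 1 i d)) K) K := by
    intro i d hd
    have hp : ∀ t ∈ unitInterval, 0 < 1 - t + t * d := by
      intro t ht
      rcases ht.1.eq_or_lt with h | h
      · simp [← h]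
      · have := ht.2
        have := mul_pos h hd
        linarith
    have := joined_path (A := A) (B := B) (C := C) (T := fun t => diagonal (Function.update (1 : Fin n → ℝ) i (1 - t + t * d)))
      (T' := fun t => diagonal (Function.update (1 : Fin n → ℝ) i (1 - t + t * d)⁻¹)) ?_ ?_ ?_ ?_ hK
    · simpa using this
    · fun_prop
    · have h1 : ContinuousOn (fun t : ℝ => (1 - t + t * d)⁻¹) unitInterval :=
        ContinuousOn.inv₀ (by fun_prop) (fun t ht => (hp t ht).ne')
      have h2 : Continuous fun z : ℝ => diagonal (Function.update (1 : Fin n → ℝ) i z) := by fun_prop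
      exact h2.comp_continuousOn h1
    · intro t ht
      rw [Matrix.diagonal_mul_diagonal, ← Matrix.diagonal_one]
      congr 1
      funext j
      by_cases hj : j = i
      · subst hj; simp [(hp t ht).ne']
      · simp [hj]
    · simp
  have hneg : ∀ i : Fin n, JoinedIn (CtlSet A B C) (act (diagonal (Function.update 1 i (-1))) K) K := by
    intro i
    obtain ⟨hR, hj⟩ := joined_reflect hK w (Pi.single i (w i)⁻¹) (by simp [hw i]) h1 h2
    set c : Fin n → ℝ := Function.update (fun j => -2 * (w i)⁻¹ * w j) i 0 with hc
    obtain ⟨hd, hj2⟩ := huni (Pi.single i 1) c (by simp [hc])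
    have := hmul _ _ (inv_of_mul hR).1 hd hj hj2
    convert this using 2
    have e1 : (1 - (2 : ℝ) • vecMulVec (Pi.single i (w i)⁻¹) w) *ᵥ (Pi.single i 1) = -(Pi.single i 1) := by
      rw [Matrix.sub_mulVec, Matrix.one_mulVec, Matrix.smul_mulVec, Matrix.vecMulVec_mulVec]
      funext j
      by_cases hj : j = i
      · subst hj; simp [hw j]; norm_num
      · simp [hj]
    rw [Matrix.mul_add, Matrix.mul_one, Matrix.mul_vecMulVec, e1]
    ext a b
    by_cases ha : a = i
    · subst ha
      by_cases hb : b = a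
      · subst hb
        simp [hc, vecMulVec_apply, hw b]; norm_num
      · simp [hc, vecMulVec_apply, hb, Ne.symm hb]; ring
    · by_cases hab : a = b
      · subst hab; simp [vecMulVec_apply, ha]
      · simp [vecMulVec_apply, ha, hab]
  have hdet1 : ∀ (i : Fin n) (d : ℝ), d ≠ 0 → (diagonal (Function.update (1 : Fin n → ℝ) i d)).det ≠ 0 := by
    intro i d hd
    rw [Matrix.det_diagonal, Finset.prod_ne_zero_iff]
    intro j _
    by_cases hj : j = i
    · subst hj; simpa
    · simp [hj]
  have hsingle : ∀ (i : Fin n) (d : ℝ), d ≠ 0 →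
      JoinedIn (CtlSet A B C) (act (diagonal (Function.update 1 i d)) K) K := by
    intro i d hd
    rcases lt_or_gt_of_ne hd with h | h
    · have := hmul _ _ (hdet1 i (-1) (by norm_num)) (hdet1 i (-d) (by linarith)) (hneg i) (hpos i (-d) (by linarith))
      convert this using 2
      rw [Matrix.diagonal_mul_diagonal]
      congr 1
      funext j
      by_cases hj : j = i
      · subst hj; simp
      · simp [hj]
    · exact hpos i d h
  refine Matrix.diagonal_transvection_induction_of_det_ne_zero
    (fun T => JoinedIn (CtlSet A B C) (act T K) K) T hT ?_ ?_ hmul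
  · intro D hD
    rw [Matrix.det_diagonal, Finset.prod_ne_zero_iff] at hD
    have key : ∀ s : Finset (Fin n), JoinedIn (CtlSet A B C)
        (act (diagonal (fun i => if i ∈ s then D i else 1)) K) K := by
      intro s
      induction s using Finset.induction_on with
      | empty =>
        simp only [Finset.notMem_empty, if_false]
        have : diagonal (fun _ : Fin n => (1 : ℝ)) = 1 := Matrix.diagonal_one
        rw [this, act_one]
        exact JoinedIn.refl hK
      | insert i s hi ih =>
        have := hmul _ _ (hdet1 i (D i) (hD i (Finset.mem_univ i))) (by
          rw [Matrix.det_diagonal, Finset.prod_ne_zero_iff]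
          intro j _
          split_ifs
          · exact hD j (Finset.mem_univ j)
          · exact one_ne_zero) (hsingle i (D i) (hD i (Finset.mem_univ i))) ih
        convert this using 2
        rw [Matrix.diagonal_mul_diagonal]
        congr 1
        funext j
        by_cases hj : j = i
        · subst hj; simp [hi]
        · simp [hj]
    simpa using key Finset.univ
  · intro t
    have := (huni (Pi.single t.i 1) (Pi.single t.j t.c) (by simp [t.hij])).2
    convert this using 2
    rw [Matrix.TransvectionStruct.toMatrix, Matrix.transvection]
    congr 1
    ext a b
    simp only [Matrix.single_apply, vecMulVec_apply, Pi.single_apply]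
    by_cases ha : a = t.i <;> by_cases hb : b = t.j <;> simp [ha, hb, eq_comm]


lemma exists_K0 (hn : 0 < n) (hctrb : Controllable A B) (hobs : Controllable Aᵀ Cᵀ) :
    ∃ K ∈ CtlSet A B C, ∃ w : Fin n → ℝ, (∀ i, w i ≠ 0) ∧ w ᵥ* K.1 = -w ∧ w ᵥ* K.2.1 = 0 := by
  have hne : Nonempty (Fin n) := ⟨⟨0, hn⟩⟩
  obtain ⟨F, hF⟩ := pole_placement hctrb
  obtain ⟨J', hJ'⟩ := pole_placement hobs
  obtain ⟨J, hJ⟩ : ∃ J : Matrix (Fin n) (Fin p) ℝ, IsNilpotent (A + J * C + 1) := by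
    refine ⟨J'ᵀ, ?_⟩
    obtain ⟨r, hr⟩ := hJ'
    refine ⟨r, ?_⟩
    have := congrArg Matrix.transpose hr
    rw [Matrix.transpose_pow] at this
    simpa [Matrix.transpose_mul] using this
  have hdet : (A + B * F + 1).det = 0 := by
    obtain ⟨r, hr⟩ := hF
    have := congrArg Matrix.det hr
    rw [Matrix.det_pow, Matrix.det_zero] at this
    by_contra hc
    exact pow_ne_zero r hc this
  obtain ⟨w, hw0, hw⟩ := Matrix.exists_vecMul_eq_zero_iff.2 hdet
  have hw1 : w ᵥ* (A + B * F) = -w := by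
    rw [Matrix.vecMul_add, Matrix.vecMul_one] at hw
    exact eq_neg_of_add_eq_zero_left hw
  have hb : w ᵥ* B ≠ 0 := by
    intro hb
    have hA : w ᵥ* A = -w := by
      rw [Matrix.vecMul_add, ← Matrix.vecMul_vecMul, hb, Matrix.zero_vecMul, add_zero] at hw1
      exact hw1
    set W : Submodule ℝ (Fin n → ℝ) := LinearMap.ker (dotProductBilin ℝ ℝ w) with hW
    have hmem : ∀ x, x ∈ W ↔ w ⬝ᵥ x = 0 := fun x => by
      rw [hW, LinearMap.mem_ker]; rfl
    have htop := hctrb.subspace W (by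
      intro x hx
      rw [hmem] at hx ⊢
      rw [Matrix.dotProduct_mulVec, hA, neg_dotProduct, hx, neg_zero]) (by
      intro u
      rw [hmem, Matrix.dotProduct_mulVec, hb, zero_dotProduct])
    have : w ∈ W := by rw [htop]; trivial
    rw [hmem] at this
    exact hw0 (dotProduct_self_eq_zero.1 this)
  set b := w ᵥ* B with hbdef
  have hbb : b ⬝ᵥ b ≠ 0 := fun h => hb (dotProduct_self_eq_zero.1 h)
  set D : Matrix (Fin m) (Fin p) ℝ := (b ⬝ᵥ b)⁻¹ • vecMulVec b (w ᵥ* J) with hD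
  have hbD : b ᵥ* D = w ᵥ* J := by
    rw [hD, Matrix.vecMul_smul, Matrix.vecMul_vecMulVec, smul_smul, inv_mul_cancel₀ hbb, one_smul]
  set L := B * D - J with hL
  have hwL : w ᵥ* L = 0 := by
    rw [hL, Matrix.vecMul_sub, ← Matrix.vecMul_vecMul, ← hbdef, hbD, sub_self]
  set K : Ctl n m p := (A + B * F - L * C, L, F - D * C, D) with hK
  have hmem : K ∈ CtlSet A B C := by
    have sF := (stable_iff _).1 (stable_of_nilpotent hF)
    have sJ := (stable_iff _).1 (stable_of_nilpotent hJ)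
    change IsStableMatrix (fromBlocks (A + B * D * C) (B * (F - D * C)) (L * C) (A + B * F - L * C))
    rw [stable_iff]
    intro a c α β hac ha hc
    have hblk : ∀ x : Fin n ⊕ Fin n → ℝ, ∀ y, 
        fromBlocks (A + B * D * C) (B * (F - D * C)) (L * C) (A + B * F - L * C) *ᵥ x = y →
        (A + J * C) *ᵥ (x ∘ Sum.inl - x ∘ Sum.inr) = y ∘ Sum.inl - y ∘ Sum.inr ∧
        (x ∘ Sum.inl - x ∘ Sum.inr = 0 → (A + B * F) *ᵥ (x ∘ Sum.inr) = y ∘ Sum.inr) := by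
      rintro x _ rfl
      rw [Matrix.fromBlocks_mulVec]
      have e1 : ∀ u v : Fin n → ℝ, Sum.elim u v ∘ Sum.inl = u := fun _ _ => rfl
      have e2 : ∀ u v : Fin n → ℝ, Sum.elim u v ∘ Sum.inr = v := fun _ _ => rfl
      rw [e1, e2]
      generalize x ∘ Sum.inl = x1
      generalize x ∘ Sum.inr = x2
      constructor
      · simp only [hL, Matrix.mulVec_sub, Matrix.add_mulVec, Matrix.sub_mulVec, Matrix.mul_sub,
          Matrix.sub_mul, Matrix.mul_assoc]
        abel
      · intro h
        rw [sub_eq_zero.1 h, ← Matrix.add_mulVec]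
        congr 1
        abel
    obtain ⟨ha1, ha2⟩ := hblk a _ ha
    obtain ⟨hc1, hc2⟩ := hblk c _ hc
    by_cases h0 : a ∘ Sum.inl - a ∘ Sum.inr = 0 ∧ c ∘ Sum.inl - c ∘ Sum.inr = 0
    · refine sF (a ∘ Sum.inr) (c ∘ Sum.inr) α β ?_ (ha2 h0.1) (hc2 h0.2)
      by_contra! hcon
      have hz : ∀ x : Fin n ⊕ Fin n → ℝ, x ∘ Sum.inl - x ∘ Sum.inr = 0 → x ∘ Sum.inr = 0 → x = 0 := by
        intro x h1 h2
        rw [h2, sub_zero] at h1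
        funext i
        rcases i with i | i
        · exact congrFun h1 i
        · exact congrFun h2 i
      rcases hac with h | h
      · exact h (hz a h0.1 hcon.1)
      · exact h (hz c h0.2 hcon.2)
    · refine sJ (a ∘ Sum.inl - a ∘ Sum.inr) (c ∘ Sum.inl - c ∘ Sum.inr) α β ?_ ?_ ?_
      · by_contra! hcon
        exact h0 hcon
      · rw [ha1]; funext i; simp; ring
      · rw [hc1]; funext i; simp; ring
  have hwK : w ᵥ* K.1 = -w := by
    change w ᵥ* (A + B * F - L * C) = -w
    rw [Matrix.vecMul_sub, hw1, ← Matrix.vecMul_vecMul, hwL, Matrix.zero_vecMul, sub_zero]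
  obtain ⟨i, hi⟩ : ∃ i, w i ≠ 0 := by
    by_contra! hcon
    exact hw0 (funext hcon)
  set c : Fin n → ℝ := fun j => if w j = 0 then 1 else 0 with hc
  have hci : c i = 0 := by simp [hc, hi]
  set E := vecMulVec (Pi.single i (1 : ℝ)) c with hE
  have hsq : E * E = 0 := by
    rw [hE, Matrix.vecMulVec_mul_vecMulVec]
    simp [hci]
  have hinv : (1 - E) * (1 + E) = 1 := by
    simp only [Matrix.sub_mul, Matrix.mul_add, Matrix.one_mul, Matrix.mul_one, hsq]
    abel
  have hinv' : (1 + E) * (1 - E) = 1 := mul_eq_one_comm.1 hinv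
  obtain ⟨hd, hi2⟩ := inv_of_mul hinv
  refine ⟨act (1 - E) K, act_mem hd hmem, w ᵥ* (1 + E), ?_, ?_, ?_⟩
  · intro j
    rw [Matrix.vecMul_add, Matrix.vecMul_one, hE, Matrix.vecMul_vecMulVec]
    by_cases hj : w j = 0
    · simp [hj, hc, hi]
    · simp [hj, hc]
  · simp only [act, hi2]
    rw [Matrix.vecMul_vecMul, ← Matrix.mul_assoc, ← Matrix.mul_assoc, hinv', Matrix.one_mul,
      ← Matrix.vecMul_vecMul, hwK, Matrix.neg_vecMul]
  · simp only [act]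
    rw [Matrix.vecMul_vecMul, ← Matrix.mul_assoc, hinv', Matrix.one_mul]
    exact hwL


/-- the closed loop matrix -/
def cl (A : Matrix (Fin n) (Fin n) ℝ) (B : Matrix (Fin n) (Fin m) ℝ)
    (C : Matrix (Fin p) (Fin n) ℝ) (K : Ctl n m p) : Matrix (Fin n ⊕ Fin n) (Fin n ⊕ Fin n) ℝ :=
  fromBlocks (A + B * K.2.2.2 * C) (B * K.2.2.1) (K.2.1 * C) K.1

/-- the linear matrix inequalities -/
structure Good (A : Matrix (Fin n) (Fin n) ℝ) (B : Matrix (Fin n) (Fin m) ℝ)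
    (C : Matrix (Fin p) (Fin n) ℝ) (X Y : Matrix (Fin n) (Fin n) ℝ) (F : Matrix (Fin m) (Fin n) ℝ)
    (G : Matrix (Fin n) (Fin p) ℝ) (H : Matrix (Fin n) (Fin n) ℝ) (D : Matrix (Fin m) (Fin p) ℝ) :
    Prop where
  symX : Xᵀ = X
  symY : Yᵀ = Y
  pos : QPos (fromBlocks X 1 1 Y)
  neg : QPos (-(fromBlocks (A * X + B * F) (A + B * D * C) H (Y * A + G * C)))

/-- the controller attached to a solution of the linear matrix inequalities -/
def Psi (A : Matrix (Fin n) (Fin n) ℝ) (B : Matrix (Fin n) (Fin m) ℝ)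
    (C : Matrix (Fin p) (Fin n) ℝ) (X Y : Matrix (Fin n) (Fin n) ℝ) (F : Matrix (Fin m) (Fin n) ℝ)
    (G : Matrix (Fin n) (Fin p) ℝ) (H : Matrix (Fin n) (Fin n) ℝ) (D : Matrix (Fin m) (Fin p) ℝ) :
    Ctl n m p :=
  ((A * X + B * F - (B * D - Y⁻¹ * G) * C * X - Y⁻¹ * H) * (X - Y⁻¹)⁻¹,
    B * D - Y⁻¹ * G, (F - D * C * X) * (X - Y⁻¹)⁻¹, D)

variable {X Y H Z : Matrix (Fin n) (Fin n) ℝ} {F : Matrix (Fin m) (Fin n) ℝ}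
    {G : Matrix (Fin n) (Fin p) ℝ} {D : Matrix (Fin m) (Fin p) ℝ}

lemma LMT_eq (K : Ctl n m p) 
    (h2 : K.2.2.1 * Z = F - K.2.2.2 * C * X)
    (h3 : Y * (K.1 * Z) = Y * (A * X + B * F) - Y * (K.2.1 * C * X) - H)
    (h4 : Y * K.2.1 = Y * (B * K.2.2.2) - G) :
    fromBlocks 1 0 Y (-Y) * cl A B C K * fromBlocks X 1 Z 0 =
      fromBlocks (A * X + B * F) (A + B * K.2.2.2 * C) H (Y * A + G * C) := by
  have e1 : B * (K.2.2.1 * Z) = B * F - B * (K.2.2.2 * C * X) := by rw [h2, Matrix.mul_sub]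
  have e4 : Y * K.2.1 * C = Y * (B * K.2.2.2) * C - G * C := by rw [h4, Matrix.sub_mul]
  rw [Matrix.mul_assoc, cl, fromBlocks_multiply, fromBlocks_multiply]
  simp only [Matrix.one_mul, Matrix.mul_one, Matrix.zero_mul, Matrix.mul_zero, add_zero]
  congr 1
  · rw [Matrix.mul_assoc B K.2.2.1, e1, Matrix.add_mul, Matrix.mul_assoc B, Matrix.mul_assoc B]
    abel
  · rw [Matrix.mul_assoc B K.2.2.1, e1, Matrix.neg_mul, Matrix.mul_add Y (K.2.1 * C * X), h3, Matrix.add_mul]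
    simp only [Matrix.mul_add, Matrix.mul_sub, Matrix.mul_assoc]
    abel
  · rw [Matrix.neg_mul, ← Matrix.mul_assoc, e4]
    simp only [Matrix.mul_add, Matrix.mul_assoc]
    abel

lemma QPos.block22 {S U V W : Matrix (Fin n) (Fin n) ℝ} (h : QPos (fromBlocks S U V W)) :
    QPos W := by
  intro x hx
  have := h (Sum.elim 0 x) (fun h0 => hx (by
    ext i; simpa using congrFun h0 (Sum.inr i)))
  have e0 : (Sum.elim 0 x : Fin n ⊕ Fin n → ℝ) ∘ Sum.inl = 0 := rfl
  have e1 : (Sum.elim 0 x : Fin n ⊕ Fin n → ℝ) ∘ Sum.inr = x := rfl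
  rw [fromBlocks_mulVec, e0, e1] at this
  simpa using this

lemma Good.detY (h : Good A B C X Y F G H D) : Y.det ≠ 0 := h.pos.block22.det_ne

lemma Good.detZ (h : Good A B C X Y F G H D) : (X - Y⁻¹).det ≠ 0 := by
  intro h0
  obtain ⟨v, hv, h1⟩ := Matrix.exists_mulVec_eq_zero_iff.2 h0
  have h2 := Matrix.eq_zero_of_mulVec_eq_zero h.pos.det_ne (v := Sum.elim v (-(Y⁻¹ *ᵥ v))) ?_
  · apply hv
    ext i; simpa using congrFun h2 (Sum.inl i)
  · rw [fromBlocks_mulVec]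
    rw [Matrix.sub_mulVec] at h1
    have e : Y *ᵥ (Y⁻¹ *ᵥ v) = v := by
      rw [Matrix.mulVec_mulVec, mul_inv_of_det h.detY, Matrix.one_mulVec]
    ext (i | i)
    · have := congrFun h1 i
      simpa [Matrix.mulVec_neg, ← sub_eq_add_neg] using this
    · simp [Matrix.mulVec_neg, e]

lemma Good.mem (h : Good A B C X Y F G H D) : Psi A B C X Y F G H D ∈ CtlSet A B C := by
  have hY := mul_inv_of_det h.detY
  have hZ := inv_mul_of_det h.detZ
  refine stable_of_criterion (fromBlocks 1 0 Y (-Y)) _ (fromBlocks X 1 (X - Y⁻¹) 0)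
    (fromBlocks X 1 1 Y) _ ?_ (LMT_eq (F := F) (H := H) (G := G)
      (Psi A B C X Y F G H D) ?_ ?_ ?_) ?_ h.pos h.neg
  · rw [fromBlocks_multiply]
    simp [Matrix.mul_sub, hY]
  · simp [Psi, Matrix.mul_assoc, hZ]
  · simp only [Psi, Matrix.mul_assoc _ (X - Y⁻¹)⁻¹, hZ, Matrix.mul_one]
    rw [Matrix.mul_sub, Matrix.mul_sub, ← Matrix.mul_assoc Y Y⁻¹ H, hY, Matrix.one_mul]
  · simp only [Psi]
    rw [Matrix.mul_sub, ← Matrix.mul_assoc Y Y⁻¹ G, hY, Matrix.one_mul]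
  · rw [fromBlocks_transpose, h.symX, h.symY]; simp

lemma continuousOn_matInv {k : Type*} [Fintype k] [DecidableEq k] {f : ℝ → Matrix k k ℝ} {s : Set ℝ}
    (hf : ContinuousOn f s) (h : ∀ t ∈ s, (f t).det ≠ 0) : ContinuousOn (fun t => (f t)⁻¹) s := by
  have h1 : ContinuousOn (fun t => (f t).det) s :=
    (Continuous.matrix_det continuous_id).comp_continuousOn hf
  have h2 : ContinuousOn (fun t => (f t).adjugate) s :=
    (Continuous.matrix_adjugate continuous_id).comp_continuousOn hf
  simp only [Matrix.inv_def, Ring.inverse_eq_inv']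
  exact (h1.inv₀ h).smul h2

lemma Good.joined {X' Y' H' : Matrix (Fin n) (Fin n) ℝ} {F' : Matrix (Fin m) (Fin n) ℝ}
    {G' : Matrix (Fin n) (Fin p) ℝ} {D' : Matrix (Fin m) (Fin p) ℝ}
    (h : Good A B C X Y F G H D) (h' : Good A B C X' Y' F' G' H' D') :
    JoinedIn (CtlSet A B C) (Psi A B C X Y F G H D) (Psi A B C X' Y' F' G' H' D') := by
  have hg : ∀ t ∈ unitInterval, Good A B C ((1 - t) • X + t • X') ((1 - t) • Y + t • Y')
      ((1 - t) • F + t • F') ((1 - t) • G + t • G') ((1 - t) • H + t • H')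
      ((1 - t) • D + t • D') := by
    intro t ht
    have ht0 : 0 ≤ t := ht.1
    have ht1 : 0 ≤ 1 - t := by linarith [ht.2]
    have hone : (1 - t) • (1 : Matrix (Fin n) (Fin n) ℝ) + t • 1 = 1 := by module
    refine ⟨?_, ?_, ?_, ?_⟩
    · simp [h.symX, h'.symX]
    · simp [h.symY, h'.symY]
    · have := h.pos.convex h'.pos ht1 ht0 (by ring)
      rwa [fromBlocks_smul, fromBlocks_smul, fromBlocks_add, hone] at this
    · have := h.neg.convex h'.neg ht1 ht0 (by ring)
      rw [smul_neg, smul_neg, ← neg_add, fromBlocks_smul, fromBlocks_smul, fromBlocks_add] at this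
      refine (congrArg (fun N => QPos (-N)) (?_ : _ = _)).mp this
      congr 1
      all_goals try simp only [Matrix.mul_add, Matrix.add_mul, Matrix.mul_smul, Matrix.smul_mul]
      all_goals module
  refine JoinedIn.ofLine (f := fun t => Psi A B C ((1 - t) • X + t • X') ((1 - t) • Y + t • Y')
      ((1 - t) • F + t • F') ((1 - t) • G + t • G') ((1 - t) • H + t • H')
      ((1 - t) • D + t • D')) ?_ (by simp) (by simp) ?_
  · have c1 : ContinuousOn (fun t : ℝ => ((1 - t) • Y + t • Y')⁻¹) unitInterval :=
      continuousOn_matInv (by fun_prop) fun t ht => (hg t ht).detY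
    have c2 : ContinuousOn (fun t : ℝ => ((1 - t) • X + t • X' - ((1 - t) • Y + t • Y')⁻¹)⁻¹)
        unitInterval :=
      continuousOn_matInv (by fun_prop) fun t ht => (hg t ht).detZ
    unfold Psi
    fun_prop
  · rintro _ ⟨t, ht, rfl⟩
    exact (hg t ht).mem

/-- controllers in normal form come from the linear matrix inequalities -/
lemma exists_good_normal (K : Ctl n m p) (hX : Xᵀ = X) (hZ : Zᵀ = Z)
    (hP : QPos (fromBlocks X Z Z Z)) (hN : QPos (-(cl A B C K * fromBlocks X Z Z Z))) :
    ∃ X Y F G H D, Good A B C X Y F G H D ∧ Psi A B C X Y F G H D = K := by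
  have hZp := hP.block22
  have hQ : QPos (X - Z) := by
    intro x hx
    have := hP (Sum.elim x (-x)) (fun h0 => hx (by
      ext i; simpa using congrFun h0 (Sum.inl i)))
    simpa [fromBlocks_mulVec, Function.comp_def, Matrix.mulVec_neg, Matrix.sub_mulVec,
      ← sub_eq_add_neg] using this
  obtain ⟨Y, hYdef⟩ : ∃ Y, Y = (X - Z)⁻¹ := ⟨_, rfl⟩
  have hYQ : Y * (X - Z) = 1 := by rw [hYdef]; exact inv_mul_of_det hQ.det_ne
  have hQY : (X - Z) * Y = 1 := by rw [hYdef]; exact mul_inv_of_det hQ.det_ne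
  have hYi : Y⁻¹ = X - Z := (inv_of_mul hYQ).2
  have hYs : Yᵀ = Y := by
    rw [hYdef, Matrix.transpose_nonsing_inv, Matrix.transpose_sub, hX, hZ]
  obtain ⟨L, hL⟩ : ∃ L : Matrix (Fin n ⊕ Fin n) (Fin n ⊕ Fin n) ℝ, L = fromBlocks 1 0 Y (-Y) :=
    ⟨_, rfl⟩
  have hLd : L.det ≠ 0 := by
    refine (inv_of_mul (T' := fromBlocks 1 0 1 (-(X - Z))) ?_).1
    rw [hL, fromBlocks_multiply, neg_mul_neg, hYQ]
    simp [fromBlocks_one]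
  have hT : fromBlocks X Z Z Z * Lᵀ = fromBlocks X 1 Z 0 := by
    rw [hL, fromBlocks_transpose, fromBlocks_multiply, Matrix.transpose_neg, hYs]
    rw [Matrix.sub_mul, sub_eq_add_neg] at hQY
    simp [hQY]
  have hR : L * fromBlocks X Z Z Z * Lᵀ = fromBlocks X 1 1 Y := by
    rw [Matrix.mul_assoc, hT, hL, fromBlocks_multiply]
    rw [Matrix.mul_sub, sub_eq_add_neg] at hYQ
    simp [hYQ]
  have hN2 := LMT_eq (A := A) (B := B) (C := C) (X := X) (Y := Y) (Z := Z)
    (F := K.2.2.2 * C * X + K.2.2.1 * Z) (G := Y * (B * K.2.2.2 - K.2.1))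
    (H := Y * (A * X + B * (K.2.2.2 * C * X + K.2.2.1 * Z) - K.2.1 * C * X - K.1 * Z)) K
    (by abel) (by simp only [Matrix.mul_sub]; abel) (by rw [Matrix.mul_sub]; abel)
  refine ⟨X, Y, K.2.2.2 * C * X + K.2.2.1 * Z, Y * (B * K.2.2.2 - K.2.1),
    Y * (A * X + B * (K.2.2.2 * C * X + K.2.2.1 * Z) - K.2.1 * C * X - K.1 * Z), K.2.2.2,
    ⟨hX, hYs, ?_, ?_⟩, ?_⟩
  · rw [← hR]; exact hP.congr L hLd
  · rw [← hN2, ← hL, ← hT]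
    have := hN.congr L hLd
    rw [Matrix.mul_neg, Matrix.neg_mul] at this
    simpa only [Matrix.mul_assoc] using this
  · have hYc : ∀ {q : ℕ} (W : Matrix (Fin n) (Fin q) ℝ), Y⁻¹ * (Y * W) = W := by
      intro q W
      rw [← Matrix.mul_assoc, hYi, hQY, Matrix.one_mul]
    have hZZ : Z * Z⁻¹ = 1 := mul_inv_of_det hZp.det_ne
    have eB : B * K.2.2.2 - (B * K.2.2.2 - K.2.1) = K.2.1 := by abel
    have eZ : X - Y⁻¹ = Z := by rw [hYi]; abel
    simp only [Psi, hYc, eB, eZ]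
    refine Prod.ext ?_ (Prod.ext rfl (Prod.ext ?_ rfl))
    · simp only [sub_sub_cancel, Matrix.mul_assoc, hZZ, Matrix.mul_one]
    · simp only [add_sub_cancel_left, Matrix.mul_assoc, hZZ, Matrix.mul_one]

/-- every stabilizing controller is, up to a change of coordinates, of the form `Psi` -/
lemma exists_good {K : Ctl n m p} (hK : K ∈ CtlSet A B C) :
    ∃ T : Matrix (Fin n) (Fin n) ℝ, T.det ≠ 0 ∧
      ∃ X Y F G H D, Good A B C X Y F G H D ∧ Psi A B C X Y F G H D = act T K := by
  have hM : IsStableMatrix (cl A B C K) := hK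
  obtain ⟨P, hPs, hPp, hPn⟩ := lyapunov _ hM
  obtain ⟨P', hPs', hPp', hPn', hU⟩ : ∃ P' : Matrix (Fin n ⊕ Fin n) (Fin n ⊕ Fin n) ℝ, P'ᵀ = P' ∧
      QPos P' ∧ QPos (-(cl A B C K * P')) ∧ P'.toBlocks₁₂.det ≠ 0 := by
    let E : Matrix (Fin n ⊕ Fin n) (Fin n ⊕ Fin n) ℝ := fromBlocks 0 1 1 0
    have hE : Eᵀ = E := by simp [E, fromBlocks_transpose]
    have c1 : Filter.Tendsto (fun t : ℝ => P + t • E) (nhdsWithin 0 {0}ᶜ) (nhds P) := by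
      have : Continuous (fun t : ℝ => P + t • E) := by fun_prop
      have h := this.tendsto 0
      simp only [zero_smul, add_zero] at h
      exact h.mono_left nhdsWithin_le_nhds
    have c2 : Filter.Tendsto (fun t : ℝ => -(cl A B C K * (P + t • E))) (nhdsWithin 0 {0}ᶜ)
        (nhds (-(cl A B C K * P))) := by
      have : Continuous (fun P : Matrix (Fin n ⊕ Fin n) (Fin n ⊕ Fin n) ℝ => -(cl A B C K * P)) := by
        fun_prop
      exact (this.tendsto P).comp c1
    have c3 : ∀ᶠ t : ℝ in nhdsWithin 0 {0}ᶜ, (P + t • E).toBlocks₁₂.det ≠ 0 := by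
      have hfin : {t : ℝ | (-P.toBlocks₁₂).charpoly.IsRoot t}.Finite :=
        Polynomial.finite_setOfPred_isRoot (Matrix.charpoly_monic _).ne_zero
      have h1 : ∀ᶠ t : ℝ in nhdsWithin 0 {0}ᶜ, t ∉ {t : ℝ | (-P.toBlocks₁₂).charpoly.IsRoot t} := by
        have h2 : ({t : ℝ | (-P.toBlocks₁₂).charpoly.IsRoot t} \ {0}).Finite := hfin.subset Set.sdiff_subset
        have h3 : ({t : ℝ | (-P.toBlocks₁₂).charpoly.IsRoot t} \ {0})ᶜ ∈ nhds (0 : ℝ) :=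
          h2.isClosed.isOpen_compl.mem_nhds (by simp)
        filter_upwards [nhdsWithin_le_nhds h3, self_mem_nhdsWithin] with t ht ht0 hr
        exact ht ⟨hr, ht0⟩
      filter_upwards [h1] with t ht h0
      apply ht
      have e : (P + t • E).toBlocks₁₂ = Matrix.scalar (Fin n) t - (-P.toBlocks₁₂) := by
        ext i j
        simp [E, Matrix.toBlocks₁₂, Matrix.scalar_apply, Matrix.diagonal_apply, Matrix.one_apply,
          add_comm]
      show (-P.toBlocks₁₂).charpoly.eval t = 0
      rw [Matrix.eval_charpoly, ← e, h0]
    obtain ⟨t, h1, h2, h3⟩ := ((hPp.eventually c1).and ((hPn.eventually c2).and c3)).exists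
    exact ⟨P + t • E, by simp [hPs, hE], h1, h2, h3⟩
  obtain ⟨X, U, V, W, rfl⟩ : ∃ X U V W, P' = fromBlocks X U V W :=
    ⟨_, _, _, _, (fromBlocks_toBlocks P').symm⟩
  rw [toBlocks_fromBlocks₁₂] at hU
  rw [fromBlocks_transpose, fromBlocks_inj] at hPs'
  obtain ⟨hX, hV, -, hW⟩ := hPs'
  have hVU : V = Uᵀ := by rw [← hV, Matrix.transpose_transpose]
  subst hVU
  have hWd := hPp'.block22.det_ne
  have hW1 := inv_mul_of_det hWd
  have hWi : W⁻¹ᵀ = W⁻¹ := by rw [Matrix.transpose_nonsing_inv, hW]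
  obtain ⟨T, hTdef⟩ : ∃ T, T = U * W⁻¹ := ⟨_, rfl⟩
  have hT : T.det ≠ 0 := by
    rw [hTdef, Matrix.det_mul]
    refine mul_ne_zero hU ?_
    intro h0
    have := congrArg Matrix.det hW1
    rw [Matrix.det_mul, h0] at this
    simp at this
  have hTT := inv_mul_of_det hT
  obtain ⟨S, hS⟩ : ∃ S : Matrix (Fin n ⊕ Fin n) (Fin n ⊕ Fin n) ℝ, S = fromBlocks 1 0 0 T := ⟨_, rfl⟩
  have hSd : S.det ≠ 0 := by rw [hS]; simpa using hT
  have e1 : T * W = U := by rw [hTdef, Matrix.mul_assoc, hW1, Matrix.mul_one]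
  have e2 : Tᵀ = W⁻¹ * Uᵀ := by rw [hTdef, Matrix.transpose_mul, hWi]
  have hSP : S * fromBlocks X U Uᵀ W * Sᵀ =
      fromBlocks X (U * W⁻¹ * Uᵀ) (U * W⁻¹ * Uᵀ) (U * W⁻¹ * Uᵀ) := by
    rw [hS, fromBlocks_transpose, fromBlocks_multiply, fromBlocks_multiply]
    have e3 : T * Uᵀ = U * W⁻¹ * Uᵀ := by rw [hTdef]
    simp [e1, e2, e3, Matrix.mul_assoc]
  have hSM : cl A B C (act T K) * S = S * cl A B C K := by
    rw [hS, cl, cl, fromBlocks_multiply, fromBlocks_multiply]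
    simp [act, Matrix.mul_assoc, hTT]
  refine ⟨T, hT, exists_good_normal (X := X) (Z := U * W⁻¹ * Uᵀ) (act T K) hX ?_ ?_ ?_⟩
  · simp [Matrix.transpose_mul, hWi, Matrix.mul_assoc]
  · rw [← hSP]; exact hPp'.congr S hSd
  · rw [← hSP, Matrix.mul_assoc S, ← Matrix.mul_assoc, hSM]
    have := hPn'.congr S hSd
    rw [Matrix.mul_neg, Matrix.neg_mul] at this
    simpa only [Matrix.mul_assoc] using this

lemma ctlSet_pathConnected (hn : 0 < n) (hctrb : Controllable A B) (hobs : Controllable Aᵀ Cᵀ) :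
    IsPathConnected (CtlSet A B C) := by
  obtain ⟨K0, hK0, w, hw, h1, h2⟩ := exists_K0 hn hctrb hobs
  refine ⟨K0, hK0, fun {K} hK => ?_⟩
  obtain ⟨T0, hT0, X0, Y0, F0, G0, H0, D0, g0, e0⟩ := exists_good hK0
  obtain ⟨T, hT, X, Y, F, G, H, D, g, e⟩ := exists_good hK
  have hj := g.joined g0
  rw [e, e0] at hj
  have hTi : T⁻¹.det ≠ 0 := (inv_of_mul (inv_mul_of_det hT)).1
  have hj2 := joined_act hTi hj
  rw [← act_mul, ← act_mul, inv_mul_of_det hT, act_one] at hj2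
  refine (hj2.trans (joined_all hK0 w hw h1 h2 (T⁻¹ * T0) ?_)).symm
  rw [Matrix.det_mul]
  exact mul_ne_zero hTi hT0

end Controllers

/-- If `(A, B)` is controllable and `(C, A)` is observable, then the set
`𝒞̂_n` of proper full-order stabilizing controllers — quadruples `(A_K, B_K, C_K, D_K)`
such that `[[A + B·D_K·C, B·C_K],[B_K·C, A_K]]` is stable — is path-connected. -/
theorem Chat_pathConnected (n m p : ℕ) (hn : 0 < n) (hm : 0 < m) (hp : 0 < p)
    (A : Matrix (Fin n) (Fin n) ℝ) (B : Matrix (Fin n) (Fin m) ℝ)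
    (C : Matrix (Fin p) (Fin n) ℝ)
    (hctrb : Controllable A B) (hobs : Controllable Aᵀ Cᵀ) :
    IsPathConnected {K : Matrix (Fin n) (Fin n) ℝ × Matrix (Fin n) (Fin p) ℝ ×
        Matrix (Fin m) (Fin n) ℝ × Matrix (Fin m) (Fin p) ℝ |
      IsStableMatrix (fromBlocks (A + B * K.2.2.2 * C) (B * K.2.2.1) (K.2.1 * C) K.1)} := by
  exact ctlSet_pathConnected hn hctrb hobs
end
end

section
/- Let K = (A_K, B_K, C_K) be a controller of order q ≥ 1. For a triple Δ = (Δ_A, Δ_B, Δ_C) ∈ ℝ^{q×q} × ℝ^{q×p} × ℝ^{m×q}, the following are equivalent: (i) for every H ∈ ℝ^{q×q}, tr(Δ_Aᵀ·(H·A_K − A_K·H)) + tr(Δ_Bᵀ·(H·B_K)) + tr(Δ_Cᵀ·(−C_K·H)) = 0; (ii) Δ_A·A_Kᵀ − A_Kᵀ·Δ_A + Δ_B·B_Kᵀ − C_Kᵀ·Δ_C = 0. Equivalently, with respect to the trace inner product, the orthogonal complement of the tangent space of the similarity-transformation orbit at K, namely of the subspace {(H·A_K − A_K·H, H·B_K,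 −C_K·H) : H ∈ ℝ^{q×q}}, is exactly {Δ : Δ_A·A_Kᵀ − A_Kᵀ·Δ_A + Δ_B·B_Kᵀ − C_Kᵀ·Δ_C = 0}. -/
open Matrix

noncomputable section

/-- For a controller `K = (A_K, B_K, C_K)` of order `q`, a direction
`Δ = (Δ_A, Δ_B, Δ_C)` is orthogonal (w.r.t. the trace inner product) to the tangent space
`{(H·A_K − A_K·H, H·B_K, −C_K·H) : H}` of the similarity-transformation orbit at `K`
if and only if `Δ_A·A_Kᵀ − A_Kᵀ·Δ_A + Δ_B·B_Kᵀ − C_Kᵀ·Δ_C = 0`. -/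
theorem orbit_tangent_orthogonal_complement (m p q : ℕ) (hq : 1 ≤ q)
    (AK : Matrix (Fin q) (Fin q) ℝ) (BK : Matrix (Fin q) (Fin p) ℝ)
    (CK : Matrix (Fin m) (Fin q) ℝ)
    (ΔA : Matrix (Fin q) (Fin q) ℝ) (ΔB : Matrix (Fin q) (Fin p) ℝ)
    (ΔC : Matrix (Fin m) (Fin q) ℝ) :
    (∀ H : Matrix (Fin q) (Fin q) ℝ,
        (ΔAᵀ * (H * AK - AK * H)).trace + (ΔBᵀ * (H * BK)).trace
          + (ΔCᵀ * (-(CK * H))).trace = 0)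
      ↔ ΔA * AKᵀ - AKᵀ * ΔA + ΔB * BKᵀ - CKᵀ * ΔC = 0 := by
  have key : ∀ H : Matrix (Fin q) (Fin q) ℝ,
      (ΔAᵀ * (H * AK - AK * H)).trace + (ΔBᵀ * (H * BK)).trace
          + (ΔCᵀ * (-(CK * H))).trace
        = ((ΔA * AKᵀ - AKᵀ * ΔA + ΔB * BKᵀ - CKᵀ * ΔC)ᵀ * H).trace := by
    intro H
    have h1 : (ΔAᵀ * (H * AK)).trace = (AK * ΔAᵀ * H).trace := by
      rw [← Matrix.mul_assoc, Matrix.trace_mul_comm, ← Matrix.mul_assoc]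
    have h2 : (ΔBᵀ * (H * BK)).trace = (BK * ΔBᵀ * H).trace := by
      rw [← Matrix.mul_assoc, Matrix.trace_mul_comm, ← Matrix.mul_assoc]
    simp only [Matrix.transpose_sub, Matrix.transpose_add, Matrix.transpose_mul,
      Matrix.transpose_transpose, Matrix.sub_mul, Matrix.add_mul, Matrix.mul_sub,
      Matrix.mul_neg, Matrix.trace_sub, Matrix.trace_add, Matrix.trace_neg, h1, h2]
    simp only [Matrix.mul_assoc]
    ring
  constructor
  · intro h
    have h0 := h (ΔA * AKᵀ - AKᵀ * ΔA + ΔB * BKᵀ - CKᵀ * ΔC)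
    rw [key, ← Matrix.conjTranspose_eq_transpose_of_trivial] at h0
    exact Matrix.trace_conjTranspose_mul_self_eq_zero_iff.mp h0
  · intro h H
    rw [key, h]
    simp
end
end
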